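/- arXiv:2504.13530 — 4 statements merged into one kernel-verified Lean document; each statement's English description precedes it below -/
import Mathlib

section
/- For every f, ξ, η ∈ C_c(Γ⋉X), every integer k ≥ 1, and every x ∈ X, one has ⟨⟨Δ^k(f)(ξ), η⟩⟩(x) = (−1)^k · ⟨⟨ξ, Δ^k(f^*)(η)⟩⟩(x). -/
open scoped ENNReal

noncomputable section

variable {Γ X : Type*} [Group Γ] [TopologicalSpace X] [MulAction Γ X]

/-- `f ∈ C_c(Γ ⋉ X)` : each `f g : X → ℂ` is continuous, and `f g ≡ 0` for all but
finitely many `g ∈ Γ`. -/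
def IsCc (f : Γ → X → ℂ) : Prop :=
  (∀ g : Γ, Continuous (f g)) ∧ {g : Γ | f g ≠ 0}.Finite

/-- Convolution: `(f ∗ ξ)(g, x) = Σ_{h ∈ Γ} f (g h⁻¹, h ⋅ x) ξ (h, x)`. -/
def convCc (f ξ : Γ → X → ℂ) : Γ → X → ℂ :=
  fun g x => ∑ᶠ h : Γ, f (g * h⁻¹) (h • x) * ξ h x

/-- Involution: `f^*(g, x) = conj (f (g⁻¹, g ⋅ x))`. -/
def starCc (f : Γ → X → ℂ) : Γ → X → ℂ :=
  fun g x => (starRingEnd ℂ) (f g⁻¹ (g • x))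

/-- Pointwise multiplication by the length function: `M_ℓ(f)(g,x) = ℓ(g,x) f(g,x)`. -/
def mulLen (ℓ : Γ → X → ℝ) (f : Γ → X → ℂ) : Γ → X → ℂ :=
  fun g x => (ℓ g x : ℂ) * f g x

/-- Iterated derivation: `Δ⁰(f)(ξ) = f ∗ ξ` and
`Δ^k(f)(ξ) = M_ℓ(Δ^{k-1}(f)(ξ)) − Δ^{k-1}(f)(M_ℓ(ξ))`. -/
def deltaIter (ℓ : Γ → X → ℝ) (f : Γ → X → ℂ) : ℕ → (Γ → X → ℂ) → Γ → X → ℂ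
  | 0, ξ => convCc f ξ
  | k + 1, ξ => mulLen ℓ (deltaIter ℓ f k ξ) - deltaIter ℓ f k (mulLen ℓ ξ)

/-- Hilbert-module norm: `‖ξ‖ = sup_{x ∈ X} (Σ_{g ∈ Γ} |ξ(g,x)|²)^{1/2}`. -/
def hnorm (ξ : Γ → X → ℂ) : ℝ :=
  ⨆ x : X, Real.sqrt (∑ᶠ g : Γ, ‖ξ g x‖ ^ 2)

/-- The I-norm `‖f‖_I`. -/
def normI (f : Γ → X → ℂ) : ℝ :=
  max (⨆ x : X, ∑ᶠ g : Γ, ‖f g x‖) (⨆ x : X, ∑ᶠ g : Γ, ‖f g⁻¹ (g • x)‖)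

/-- The `C(X)`-valued inner product: `⟨⟨ξ, η⟩⟩(x) = Σ_{g ∈ Γ} conj(ξ(g,x)) η(g,x)`. -/
def innerCc (ξ η : Γ → X → ℂ) (x : X) : ℂ :=
  ∑ᶠ g : Γ, (starRingEnd ℂ) (ξ g x) * η g x

/-- Reduced norm: `‖f‖_red = sup { ‖f ∗ ξ‖ : ξ ∈ C_c, ‖ξ‖ ≤ 1 }`. -/
def redNorm (f : Γ → X → ℂ) : ℝ :=
  sSup {r : ℝ | ∃ ξ : Γ → X → ℂ, IsCc ξ ∧ hnorm ξ ≤ 1 ∧ r = hnorm (convCc f ξ)}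

/-- The quasi-seminorm `L_ℓ^k(f) = sup { ‖Δ^k(f)(ξ)‖ : ξ ∈ C_c, ‖ξ‖ ≤ 1 }`. -/
def lipK (ℓ : Γ → X → ℝ) (k : ℕ) (f : Γ → X → ℂ) : ℝ :=
  sSup {r : ℝ | ∃ ξ : Γ → X → ℂ, IsCc ξ ∧ hnorm ξ ≤ 1 ∧ r = hnorm (deltaIter ℓ f k ξ)}

/-- `‖f‖_{2,p,s,ℓ}`. -/
def norm2s (ℓ : Γ → X → ℝ) (p : ℝ) (f : Γ → X → ℂ) : ℝ :=
  ⨆ x : X, Real.sqrt (∑ᶠ g : Γ, ‖f g x‖ ^ 2 * (1 + ℓ g x) ^ (2 * p))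

/-- `‖f‖_{2,p,r,ℓ}`. -/
def norm2r (ℓ : Γ → X → ℝ) (p : ℝ) (f : Γ → X → ℂ) : ℝ :=
  ⨆ x : X, Real.sqrt (∑ᶠ g : Γ, ‖f g⁻¹ (g • x)‖ ^ 2 * (1 + ℓ g x) ^ (2 * p))

/-- `‖f‖_{2,p,ℓ} = max (‖f‖_{2,p,s,ℓ}, ‖f‖_{2,p,r,ℓ})`. -/
def norm2 (ℓ : Γ → X → ℝ) (p : ℝ) (f : Γ → X → ℂ) : ℝ :=
  max (norm2s ℓ p f) (norm2r ℓ p f)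

/-- A length function on the transformation groupoid `Γ ⋉ X`. -/
def IsLength (ℓ : Γ → X → ℝ) : Prop :=
  (∀ g : Γ, Continuous (ℓ g)) ∧ (∀ (g : Γ) (x : X), 0 ≤ ℓ g x) ∧
    (∀ (g : Γ) (x : X), ℓ g x = 0 ↔ g = 1) ∧
    (∀ (g : Γ) (x : X), ℓ g⁻¹ (g • x) = ℓ g x) ∧
    (∀ (g h : Γ) (x : X), ℓ (g * h) x ≤ ℓ g (h • x) + ℓ h x)

/-- Properness: for every `R ≥ 0`, only finitely many non-identity `g` satisfy
`ℓ(g, x) ≤ R` for some `x`. -/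
def IsProperLen (ℓ : Γ → X → ℝ) : Prop :=
  ∀ R : ℝ, {g : Γ | g ≠ 1 ∧ ∃ x : X, ℓ g x ≤ R}.Finite

theorem finite_support_eval_of_isCc {Γ X : Type*} [TopologicalSpace X]
    {ξ : Γ → X → ℂ} (hξ : IsCc ξ) (x : X) :
    (Function.support fun g => ξ g x).Finite :=
  hξ.2.subset fun _ hg h => hg (congrFun h x)

theorem finite_support_eval_mulLen {Γ X : Type*}
    (ℓ : Γ → X → ℝ) {ξ : Γ → X → ℂ} {x : X}
    (hξ : (Function.support fun g => ξ g x).Finite) :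
    (Function.support fun g => mulLen ℓ ξ g x).Finite :=
  hξ.subset (Function.support_mul_subset_right _ _)

theorem innerCc_mulLen_left {Γ X : Type*}
    (ℓ : Γ → X → ℝ) (ξ η : Γ → X → ℂ) (x : X) :
    innerCc (mulLen ℓ ξ) η x = innerCc ξ (mulLen ℓ η) x := by
  refine finsum_congr fun g => ?_
  simp only [mulLen, map_mul, Complex.conj_ofReal]
  ring

theorem innerCc_sub_left {Γ X : Type*}
    (ξ ξ' : Γ → X → ℂ) {η : Γ → X → ℂ} {x : X}
    (hη : (Function.support fun g => η g x).Finite) :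
    innerCc (ξ - ξ') η x = innerCc ξ η x - innerCc ξ' η x := by
  simp only [innerCc, Pi.sub_apply, map_sub, sub_mul]
  exact finsum_sub_distrib (hη.subset (Function.support_mul_subset_right _ _))
    (hη.subset (Function.support_mul_subset_right _ _))

theorem innerCc_sub_right {Γ X : Type*}
    {ξ : Γ → X → ℂ} (η η' : Γ → X → ℂ) {x : X}
    (hξ : (Function.support fun g => ξ g x).Finite) :
    innerCc ξ (η - η') x = innerCc ξ η x - innerCc ξ η' x := by
  have key (ζ : Γ → X → ℂ) :
      (Function.support fun g => (starRingEnd ℂ) (ξ g x) * ζ g x).Finite :=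
    hξ.subset fun g hg h => hg (by simp [show ξ g x = 0 from h])
  simp only [innerCc, Pi.sub_apply, mul_sub]
  exact finsum_sub_distrib (key η) (key η')

theorem innerCc_convCc_left {Γ X : Type*} [Group Γ] [MulAction Γ X]
    (f : Γ → X → ℂ) {ξ η : Γ → X → ℂ} {x : X}
    (hξ : (Function.support fun g => ξ g x).Finite)
    (hη : (Function.support fun g => η g x).Finite) :
    innerCc (convCc f ξ) η x = innerCc ξ (convCc (starCc f) η) x := by
  have conv_ξ (g : Γ) :
      convCc f ξ g x = ∑ h ∈ hξ.toFinset, f (g * h⁻¹) (h • x) * ξ h x :=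
    finsum_eq_sum_of_support_subset _ fun h hh => by
      simpa using right_ne_zero_of_mul hh
  have conv_η (h : Γ) :
      convCc (starCc f) η h x =
        ∑ g ∈ hη.toFinset, starCc f (h * g⁻¹) (g • x) * η g x :=
    finsum_eq_sum_of_support_subset _ fun g hg => by
      simpa using right_ne_zero_of_mul hg
  have inner_left : innerCc (convCc f ξ) η x =
      ∑ g ∈ hη.toFinset, (starRingEnd ℂ) (convCc f ξ g x) * η g x :=
    finsum_eq_sum_of_support_subset _ fun g hg => by
      simpa using right_ne_zero_of_mul hg
  have inner_right : innerCc ξ (convCc (starCc f) η) x =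
      ∑ h ∈ hξ.toFinset, (starRingEnd ℂ) (ξ h x) * convCc (starCc f) η h x :=
    finsum_eq_sum_of_support_subset _ fun h hh => by
      simpa using left_ne_zero_of_mul hh
  simp only [inner_left, inner_right, conv_ξ, conv_η, map_sum, Finset.sum_mul, Finset.mul_sum]
  rw [Finset.sum_comm]
  refine Finset.sum_congr rfl fun h _ => Finset.sum_congr rfl fun g _ => ?_
  simp only [starCc, map_mul, mul_inv_rev, inv_inv, smul_smul, inv_mul_cancel_right]
  ring

theorem innerCc_deltaIter_left {Γ X : Type*} [Group Γ] [MulAction Γ X]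
    (ℓ : Γ → X → ℝ) (f : Γ → X → ℂ) (k : ℕ) {ξ η : Γ → X → ℂ} {x : X}
    (hξ : (Function.support fun g => ξ g x).Finite)
    (hη : (Function.support fun g => η g x).Finite) :
    innerCc (deltaIter ℓ f k ξ) η x =
      (-1 : ℂ) ^ k * innerCc ξ (deltaIter ℓ (starCc f) k η) x := by
  induction k generalizing ξ η with
  | zero => simpa [deltaIter] using innerCc_convCc_left f hξ hη
  | succ k ih =>
    rw [deltaIter, deltaIter, innerCc_sub_left _ _ hη, innerCc_sub_right _ _ hξ,
      innerCc_mulLen_left, ih hξ (finite_support_eval_mulLen ℓ hη),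
      ih (finite_support_eval_mulLen ℓ hξ) hη, innerCc_mulLen_left]
    ring

/-- `⟨⟨Δ^k(f)(ξ), η⟩⟩(x) = (−1)^k ⟨⟨ξ, Δ^k(f^*)(η)⟩⟩(x)`. -/
theorem stmt_4 [CompactSpace X] [T2Space X] [ContinuousConstSMul Γ X]
    (ℓ : Γ → X → ℝ) (hℓ : IsLength ℓ)
    (f ξ η : Γ → X → ℂ) (hf : IsCc f) (hξ : IsCc ξ) (hη : IsCc η)
    (k : ℕ) (hk : 1 ≤ k) (x : X) :
    innerCc (deltaIter ℓ f k ξ) η x = (-1 : ℂ) ^ k * innerCc ξ (deltaIter ℓ (starCc f) k η) x := by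
  exact innerCc_deltaIter_left ℓ f k (finite_support_eval_of_isCc hξ x)
    (finite_support_eval_of_isCc hη x)
end
end

section
/- Let f ∈ C_c(Γ⋉X) and let k ≥ 1 be an integer. Then Δ^k(f)(ξ) = 0 for every ξ ∈ C_c(Γ⋉X) if and only if f(g,x) = 0 for all g ∈ Γ with g ≠ e and all x ∈ X (i.e., f belongs to the copy of C(X) supported on the unit space {e}×X). -/
open scoped ENNReal

noncomputable section

variable {Γ X : Type*} [Group Γ] [TopologicalSpace X] [MulAction Γ X]

/-- The closed formula
`Δ^k(f)(ξ)(g, x) = Σ_h (ℓ(g, x) - ℓ(h, x))^k f(g h⁻¹, h ⋅ x) ξ(h, x)`. -/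
theorem deltaIter_apply (ℓ : Γ → X → ℝ) (f : Γ → X → ℂ) (k : ℕ) (ξ : Γ → X → ℂ)
    (hξ : {h : Γ | ξ h ≠ 0}.Finite) (g : Γ) (x : X) :
    deltaIter ℓ f k ξ g x =
      ∑ᶠ h : Γ, ((ℓ g x : ℂ) - ℓ h x) ^ k * (f (g * h⁻¹) (h • x) * ξ h x) := by
  have support_finite {η : Γ → X → ℂ} (hη : {h : Γ | η h ≠ 0}.Finite) (c : Γ → ℂ) :
      (Function.support fun h => c h * (f (g * h⁻¹) (h • x) * η h x)).Finite := by
    refine hη.subset fun h hh h0 => hh ?_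
    simp [h0]
  induction k generalizing ξ with
  | zero => simp [deltaIter, convCc]
  | succ k ih =>
    have hm : {h : Γ | mulLen ℓ ξ h ≠ 0}.Finite := by
      refine hξ.subset fun h hh h0 => hh ?_
      funext y
      simp [mulLen, h0]
    change (ℓ g x : ℂ) * deltaIter ℓ f k ξ g x - deltaIter ℓ f k (mulLen ℓ ξ) g x = _
    rw [ih ξ hξ, ih _ hm, mul_finsum, ← finsum_sub_distrib]
    · refine finsum_congr fun h => ?_
      simp only [mulLen]
      ring
    · refine (support_finite hξ fun h => (ℓ g x : ℂ) * ((ℓ g x : ℂ) - ℓ h x) ^ k).subset ?_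
      intro h hh
      simpa only [Function.mem_support, mul_assoc] using hh
    · exact support_finite hm _

/-- `Δ^k(f) = 0` iff `f` vanishes off the unit space, i.e. `f ∈ C(X)`. -/
theorem stmt_7 [CompactSpace X] [T2Space X] [ContinuousConstSMul Γ X]
    (ℓ : Γ → X → ℝ) (hℓ : IsLength ℓ)
    (f : Γ → X → ℂ) (hf : IsCc f) (k : ℕ) (hk : 1 ≤ k) :
    (∀ ξ : Γ → X → ℂ, IsCc ξ → deltaIter ℓ f k ξ = 0) ↔
      ∀ (g : Γ) (x : X), g ≠ 1 → f g x = 0 := by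
  constructor
  · classical
    intro h g x hg
    let δ : Γ → X → ℂ := fun a _ => if a = 1 then 1 else 0
    have hδ : IsCc δ := by
      refine ⟨fun a => continuous_const, (Set.finite_singleton (1 : Γ)).subset fun a ha => ?_⟩
      by_contra hne
      refine ha (funext fun y => ?_)
      exact if_neg hne
    have h0 := congrFun (congrFun (h δ hδ) g) x
    rw [deltaIter_apply ℓ f k δ hδ.2, finsum_eq_single _ (1 : Γ)] at h0
    · have hl : ℓ 1 x = 0 := (hℓ.2.2.1 1 x).2 rfl
      have hne : ℓ g x ≠ 0 := fun h => hg ((hℓ.2.2.1 g x).1 h)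
      simpa [δ, hl, hne] using h0
    · intro a ha
      simp [δ, ha]
  · intro h ξ hξ
    funext g x
    rw [deltaIter_apply ℓ f k ξ hξ.2]
    refine finsum_eq_zero_of_forall_eq_zero fun a => ?_
    by_cases ha : g = a
    · simp [ha, Nat.one_le_iff_ne_zero.1 hk]
    · rw [h _ _ fun h1 => ha (mul_inv_eq_one.1 h1)]
      simp
end
end

section
/- Let A be a complex Banach space and let L : A → [0,∞] satisfy L(a+b) ≤ L(a)+L(b) and L(z·a) = |z|·L(a) for all a, b ∈ A and z ∈ ℂ. Set K = {a ∈ A : L(a) = 0} and assume K is a closed subspace. Let P : A → A be a bounded linear map with range contained in K and P(a) = a for all a ∈ K, and assume the set B = {a ∈ A : L(a) < ∞} is dense in A. Fix a continuous linear functional η on K and let S_η = { μ in the continuous dual of A : ‖μ‖ = 1 and μ(a) = η(a) for all a ∈ K }, equipped with the metric ρ_L(μ,ν) = sup{ |μ(a) − ν(a)| : a ∈ A, L(a) ≤ 1 }. If the set { b ∈ B : L(b) ≤ 1 and P(b) = 0 } is totally bounded in A, then on S_η the topology induced by ρ_L coincides with the subspace topology inherited from the weak-* topology on the dual of A. -/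
open scoped ENNReal

/-- Two functionals of norm one are close at `a` if they are close at a nearby point `f`. -/
lemma norm_sub_apply_le_of_norm_eq_one {A : Type*} [NormedAddCommGroup A] [NormedSpace ℂ A]
    {μ ν : A →L[ℂ] ℂ} (hμ : ‖μ‖ = 1) (hν : ‖ν‖ = 1) (a f : A) :
    ‖μ a - ν a‖ ≤ ‖μ f - ν f‖ + 2 * ‖a - f‖ := by
  have h : μ a - ν a = (μ f - ν f) + (μ (a - f) - ν (a - f)) := by
    simp only [map_sub]; ring
  have h1 := μ.le_opNorm (a - f)
  have h2 := ν.le_opNorm (a - f)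
  rw [hμ, one_mul] at h1
  rw [hν, one_mul] at h2
  have h3 := norm_add_le (μ f - ν f) (μ (a - f) - ν (a - f))
  have h4 := norm_sub_le (μ (a - f)) (ν (a - f))
  rw [h]
  linarith

/-- If `‖μ b - ν b‖ ≤ δ` on the unit ball of a homogeneous `L`, then it is at most `M * δ` on the
ball of radius `M`. -/
lemma norm_sub_apply_le_mul_of_le {A : Type*} [NormedAddCommGroup A] [NormedSpace ℂ A]
    {L : A → ℝ≥0∞} (hsmul : ∀ (z : ℂ) (a : A), L (z • a) = ENNReal.ofReal ‖z‖ * L a)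
    {μ ν : A →L[ℂ] ℂ} {δ M : ℝ} (hM : 0 < M) (h : ∀ b, L b ≤ 1 → ‖μ b - ν b‖ ≤ δ)
    {b : A} (hb : L b ≤ ENNReal.ofReal M) : ‖μ b - ν b‖ ≤ M * δ := by
  have hn : ‖((M⁻¹ : ℝ) : ℂ)‖ = M⁻¹ := by
    rw [Complex.norm_real, Real.norm_of_nonneg (inv_pos.2 hM).le]
  have h1 : L (((M⁻¹ : ℝ) : ℂ) • b) ≤ 1 := by
    rw [hsmul, hn]
    calc _ ≤ ENNReal.ofReal M⁻¹ * ENNReal.ofReal M := by gcongr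
      _ = 1 := by
        rw [← ENNReal.ofReal_mul (inv_pos.2 hM).le, inv_mul_cancel₀ hM.ne', ENNReal.ofReal_one]
  have h2 := h _ h1
  rw [map_smul, map_smul, ← smul_sub, norm_smul, hn, inv_mul_le_iff₀ hM] at h2
  exact h2

/-- if the set `{b ∈ B : L b ≤ 1, P b = 0}` is totally bounded in the
Banach space `A`, then on `S_η` the metric topology of `ρ_L` coincides with the
weak-* topology (expressed through the coincidence of neighbourhood filters, using
the canonical neighbourhood bases of the two topologies). -/
theorem stmt_10 {A : Type*} [NormedAddCommGroup A] [NormedSpace ℂ A] [CompleteSpace A]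
    (L : A → ℝ≥0∞)
    (hadd : ∀ a b : A, L (a + b) ≤ L a + L b)
    (hsmul : ∀ (z : ℂ) (a : A), L (z • a) = ENNReal.ofReal ‖z‖ * L a)
    (K : Submodule ℂ A) (hK : (K : Set A) = {a : A | L a = 0})
    (hKclosed : IsClosed (K : Set A))
    (P : A →L[ℂ] A) (hPrange : ∀ a : A, P a ∈ K) (hPid : ∀ a ∈ K, P a = a)
    (hdense : Dense {a : A | L a ≠ ⊤})
    (η : K →L[ℂ] ℂ)
    (S : Set (A →L[ℂ] ℂ))
    (hS : S = {μ : A →L[ℂ] ℂ | ‖μ‖ = 1 ∧ ∀ a : K, μ (a : A) = η a})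
    (ρ : (A →L[ℂ] ℂ) → (A →L[ℂ] ℂ) → ℝ≥0∞)
    (hρ : ∀ μ ν : A →L[ℂ] ℂ, ρ μ ν = ⨆ b : {b : A // L b ≤ 1}, ENNReal.ofReal ‖μ b.1 - ν b.1‖)
    (htb : TotallyBounded {a : A | L a ≠ ⊤ ∧ L a ≤ 1 ∧ P a = 0}) :
    ∀ μ ∈ S, ∀ V : Set (A →L[ℂ] ℂ),
      (∃ ε : ℝ, 0 < ε ∧ {ν | ν ∈ S ∧ ρ μ ν < ENNReal.ofReal ε} ⊆ V) ↔
        (∃ (F : Finset A) (ε : ℝ), 0 < ε ∧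
          {ν | ν ∈ S ∧ ∀ a ∈ F, ‖μ a - ν a‖ < ε} ⊆ V) := by
  subst hS
  have hL0 : ∀ k ∈ K, L k = 0 := fun k hk => by
    have : k ∈ (K : Set A) := hk
    rwa [hK] at this
  rintro μ ⟨hμ, hμη⟩ V
  constructor
  · rintro ⟨ε, hε, hV⟩
    obtain ⟨t, ht, hcov⟩ := Metric.totallyBounded_iff.1 htb (ε / 8) (by positivity)
    refine ⟨ht.toFinset, ε / 4, by positivity, fun ν hν => hV ⟨hν.1, ?_⟩⟩
    obtain ⟨⟨hν1, hνη⟩, hνF⟩ := hν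
    refine lt_of_le_of_lt (b := ENNReal.ofReal (ε / 2)) ?_
      ((ENNReal.ofReal_lt_ofReal_iff hε).2 (by linarith))
    rw [hρ]
    refine iSup_le fun ⟨b, hb⟩ => ENNReal.ofReal_le_ofReal ?_
    have hPb : P b ∈ K := hPrange b
    have hLc : L (b - P b) ≤ 1 := by
      rw [sub_eq_add_neg]
      refine (hadd _ _).trans ?_
      rwa [hL0 _ (K.neg_mem hPb), add_zero]
    have hc : b - P b ∈ {a : A | L a ≠ ⊤ ∧ L a ≤ 1 ∧ P a = 0} :=
      ⟨(hLc.trans_lt ENNReal.one_lt_top).ne, hLc, by rw [map_sub, hPid _ hPb, sub_self]⟩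
    obtain ⟨f, hf, hcf⟩ := Set.mem_iUnion₂.1 (hcov hc)
    rw [Metric.mem_ball, dist_eq_norm] at hcf
    have h1 := hνF f (ht.mem_toFinset.2 hf)
    have h2 := norm_sub_apply_le_of_norm_eq_one hμ hν1 (b - P b) f
    have h3 : μ (b - P b) - ν (b - P b) = μ b - ν b := by
      have e : μ (P b) = ν (P b) := (hμη ⟨_, hPb⟩).trans (hνη ⟨_, hPb⟩).symm
      rw [map_sub, map_sub, e]; ring
    rw [h3] at h2
    change ‖μ b - ν b‖ ≤ _
    linarith
  · rintro ⟨F, ε, hε, hV⟩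
    have happrox : ∀ a : A, ∃ b, L b ≠ ⊤ ∧ ‖a - b‖ < ε / 8 := fun a => by
      obtain ⟨b, hb, hab⟩ := hdense.exists_dist_lt a (show 0 < ε / 8 by positivity)
      exact ⟨b, hb, by rwa [← dist_eq_norm]⟩
    choose g hg hag using happrox
    set M : ℝ := ∑ a ∈ F, (L (g a)).toReal + 1 with hMdef
    have hM : 0 < M := by positivity
    refine ⟨ε / (2 * M), by positivity, fun ν hν => hV ⟨hν.1, fun a ha => ?_⟩⟩
    obtain ⟨⟨hν1, -⟩, hνρ⟩ := hν
    have hball : ∀ b, L b ≤ 1 → ‖μ b - ν b‖ ≤ ε / (2 * M) := fun b hb => by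
      rw [hρ] at hνρ
      have h := (le_iSup (fun b : {b : A // L b ≤ 1} => ENNReal.ofReal ‖μ b.1 - ν b.1‖)
        ⟨b, hb⟩).trans hνρ.le
      exact (ENNReal.ofReal_le_ofReal_iff (by positivity)).1 h
    have hgM : L (g a) ≤ ENNReal.ofReal M := by
      rw [ENNReal.le_ofReal_iff_toReal_le (hg a) hM.le]
      have := Finset.single_le_sum (f := fun a => (L (g a)).toReal)
        (fun _ _ => ENNReal.toReal_nonneg) ha
      linarith
    have h1 := norm_sub_apply_le_mul_of_le hsmul hM hball hgM
    have h2 := norm_sub_apply_le_of_norm_eq_one hμ hν1 a (g a)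
    have h3 : M * (ε / (2 * M)) = ε / 2 := by field_simp
    have h4 := hag a
    linarith
end

section
/- Let ℓ be a continuous proper length function on Γ⋉X and let p > 0. Suppose Γ⋉X has the rapid decay property with respect to ℓ and p with constant C > 0, i.e., ‖f‖_red ≤ C·‖f‖_{2,p,ℓ} for all f ∈ C_c(Γ⋉X). Then for every integer k > p there exists α > 0 such that ‖f − f|_X‖_red ≤ C·α·L_ℓ^k(f) for all f ∈ C_c(Γ⋉X), where f|_X ∈ C_c(Γ⋉X) is defined by f|_X(e,x) = f(e,x) and f|_X(g,x) = 0 for g ≠ e. -/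
open scoped ENNReal

noncomputable section

variable {Γ X : Type*} [Group Γ] [TopologicalSpace X] [MulAction Γ X]

lemma sum_le_finsum_of_nonneg {ι : Type*} {u : ι → ℝ} (hu : ∀ i, 0 ≤ u i)
    (hfin : (Function.support u).Finite) (T : Finset ι) : ∑ i ∈ T, u i ≤ ∑ᶠ i, u i := by
  classical
  rw [finsum_eq_sum_of_support_subset (s := hfin.toFinset ∪ T) u (fun i hi => by simp [hi])]
  exact Finset.sum_le_sum_of_subset_of_nonneg Finset.subset_union_right fun i _ _ => hu i

lemma finsum_le_of_forall_sum_le {ι : Type*} {u : ι → ℝ} {B : ℝ} (hB : 0 ≤ B)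
    (h : ∀ T : Finset ι, ∑ i ∈ T, u i ≤ B) : ∑ᶠ i, u i ≤ B := by
  classical
  rw [finsum_def]
  split_ifs with hu
  · exact h _
  · exact hB

lemma convCc_eq_sum {Y : Type*} [MulAction Γ Y] {f : Γ → Y → ℂ} {F : Finset Γ}
    (hF : ∀ s, s ∉ F → f s = 0) (ξ : Γ → Y → ℂ) (g : Γ) (x : Y) :
    convCc f ξ g x = ∑ s ∈ F, f s ((s⁻¹ * g) • x) * ξ (s⁻¹ * g) x := by
  have e : convCc f ξ g x = ∑ᶠ s : Γ, f s ((s⁻¹ * g) • x) * ξ (s⁻¹ * g) x := by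
    unfold convCc
    rw [← finsum_comp_equiv ((Equiv.inv Γ).trans (Equiv.mulRight g))]
    simp
  rw [e]
  apply finsum_eq_sum_of_support_subset
  intro s hs
  by_contra hsF
  exact hs (by simp [hF s hsF])

/-- `Δ^k(f)` is the integral operator with kernel `(ℓ(g,x) - ℓ(h,x))^k f(gh⁻¹, h • x)`. -/
lemma deltaIter_eq_sum (ℓ : Γ → X → ℝ) {f : Γ → X → ℂ} {F : Finset Γ}
    (hF : ∀ s, s ∉ F → f s = 0) (k : ℕ) (ξ : Γ → X → ℂ) (g : Γ) (x : X) :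
    deltaIter ℓ f k ξ g x = ∑ s ∈ F,
      ((ℓ g x : ℂ) - ℓ (s⁻¹ * g) x) ^ k * f s ((s⁻¹ * g) • x) * ξ (s⁻¹ * g) x := by
  induction k generalizing ξ with
  | zero => simp [deltaIter, convCc_eq_sum hF]
  | succ k ih =>
    simp only [deltaIter, Pi.sub_apply, mulLen, ih, Finset.mul_sum, ← Finset.sum_sub_distrib]
    refine Finset.sum_congr rfl fun s _ => ?_
    ring

lemma deltaIter_support_finite (ℓ : Γ → X → ℝ) {f ξ : Γ → X → ℂ} (hf : IsCc f) (hξ : IsCc ξ)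
    (k : ℕ) : {g : Γ | deltaIter ℓ f k ξ g ≠ 0}.Finite := by
  refine (Set.Finite.image2 (· * ·) hf.2 hξ.2).subset fun g hg => ?_
  obtain ⟨x, hx⟩ := Function.ne_iff.1 hg
  rw [deltaIter_eq_sum (F := hf.2.toFinset) ℓ (fun s hs => by simpa using hs)] at hx
  obtain ⟨s, hs, hne⟩ := Finset.exists_ne_zero_of_sum_ne_zero hx
  refine ⟨s, by simpa using hs, s⁻¹ * g, fun h => hne ?_, by simp⟩
  simp [h]

lemma IsLength.abs_sub_le {ℓ : Γ → X → ℝ} (hℓ : IsLength ℓ) (s g : Γ) (x : X) :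
    |ℓ g x - ℓ (s⁻¹ * g) x| ≤ ℓ s ((s⁻¹ * g) • x) := by
  obtain ⟨-, -, -, hinv, htri⟩ := hℓ
  have h1 := htri s (s⁻¹ * g) x
  have h2 := htri s⁻¹ g x
  have h3 := hinv s ((s⁻¹ * g) • x)
  simp only [smul_smul, mul_inv_cancel_left] at h1 h3
  rw [abs_le]
  constructor <;> linarith

/-- On the complement of the unit space, a proper length function on a compact base is bounded
away from zero. -/
lemma IsLength.exists_pos_le [CompactSpace X] {ℓ : Γ → X → ℝ} (hℓ : IsLength ℓ)
    (hprop : IsProperLen ℓ) : ∃ c : ℝ, 0 < c ∧ ∀ g : Γ, g ≠ 1 → ∀ x : X, c ≤ ℓ g x := by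
  obtain ⟨hcont, hnn, hzero, -, -⟩ := hℓ
  have hloc : ∀ g : Γ, g ≠ 1 → ∃ c : ℝ, 0 < c ∧ ∀ x : X, c ≤ ℓ g x := by
    intro g hg
    rcases isEmpty_or_nonempty X with h | h
    · exact ⟨1, one_pos, fun x => h.elim x⟩
    · obtain ⟨x₀, -, hx₀⟩ := isCompact_univ.exists_isMinOn Set.univ_nonempty
        (hcont g).continuousOn
      exact ⟨ℓ g x₀, (hnn g x₀).lt_of_ne fun h0 => hg ((hzero g x₀).1 h0.symm),
        fun x => hx₀ (Set.mem_univ x)⟩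
  have key : ∀ T : Finset Γ, (∀ g ∈ T, g ≠ 1) →
      ∃ c : ℝ, 0 < c ∧ c ≤ 1 ∧ ∀ g ∈ T, ∀ x : X, c ≤ ℓ g x := by
    classical
    intro T
    induction T using Finset.induction_on with
    | empty => exact fun _ => ⟨1, one_pos, le_rfl, by simp⟩
    | insert a T _ ih =>
      intro hT
      obtain ⟨c, hc, hc1, h⟩ := ih fun g hg => hT g (Finset.mem_insert_of_mem hg)
      obtain ⟨d, hd, h'⟩ := hloc a (hT a (Finset.mem_insert_self _ _))
      refine ⟨min c d, lt_min hc hd, (min_le_left _ _).trans hc1, fun g hg x => ?_⟩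
      rcases Finset.mem_insert.1 hg with rfl | hg
      · exact (min_le_right _ _).trans (h' x)
      · exact (min_le_left _ _).trans (h g hg x)
  obtain ⟨c, hc, hc1, h⟩ := key (hprop 1).toFinset fun g hg => by
    simp only [Set.Finite.mem_toFinset, Set.mem_ofPred_eq] at hg
    exact hg.1
  refine ⟨c, hc, fun g hg x => ?_⟩
  by_cases hx : ℓ g x ≤ 1
  · exact h g (by simpa using ⟨hg, x, hx⟩) x
  · linarith

lemma IsCc.sum_sq_le_one {ι Y : Type*} [TopologicalSpace Y] [CompactSpace Y] {ξ : ι → Y → ℂ}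
    (hξ : IsCc ξ) (h1 : hnorm ξ ≤ 1) (x : Y) (T : Finset ι) : ∑ g ∈ T, ‖ξ g x‖ ^ 2 ≤ 1 := by
  have hsupp : ∀ y, (Function.support fun g => ‖ξ g y‖ ^ 2) ⊆ hξ.2.toFinset := by
    intro y g hg
    simp only [Set.Finite.coe_toFinset, Set.mem_ofPred_eq]
    rintro h
    exact hg (by simp [h])
  have hbdd : BddAbove (Set.range fun y => Real.sqrt (∑ᶠ g : ι, ‖ξ g y‖ ^ 2)) := by
    simp_rw [fun y => finsum_eq_sum_of_support_subset _ (hsupp y)]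
    refine (isCompact_range (Continuous.sqrt ?_)).bddAbove
    exact continuous_finsetSum _ fun g _ => (hξ.1 g).norm.pow 2
  have h2 := (le_ciSup hbdd x).trans h1
  have h3 : ∑ᶠ g : ι, ‖ξ g x‖ ^ 2 ≤ 1 := by
    simpa using (Real.sqrt_le_left zero_le_one).1 h2
  exact (sum_le_finsum_of_nonneg (fun _ => sq_nonneg _)
    (hξ.2.toFinset.finite_toSet.subset (hsupp x)) T).trans h3

/-- The matrix coefficients of `Δ^k(f)` are uniformly bounded and supported on finitely many
diagonals, so `Δ^k(f)` is bounded. -/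
lemma exists_sum_sq_deltaIter_le [CompactSpace X] {ℓ : Γ → X → ℝ} {f : Γ → X → ℂ}
    (hℓ : IsLength ℓ) (hf : IsCc f) (k : ℕ) : ∃ B : ℝ, 0 ≤ B ∧ ∀ ξ : Γ → X → ℂ, IsCc ξ → hnorm ξ ≤ 1 →
      ∀ (x : X) (T : Finset Γ), ∑ g ∈ T, ‖deltaIter ℓ f k ξ g x‖ ^ 2 ≤ B := by
  classical
  set F := hf.2.toFinset with hFdef
  have hF : ∀ s, s ∉ F → f s = 0 := fun s hs => by simpa [hFdef] using hs
  have hM : ∀ s : Γ, ∃ M : ℝ, ∀ y : X, ℓ s y ^ k * ‖f s y‖ ≤ M := by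
    intro s
    obtain ⟨M, hM⟩ := (isCompact_range (((hℓ.1 s).pow k).mul (hf.1 s).norm)).bddAbove
    exact ⟨M, fun y => hM ⟨y, rfl⟩⟩
  choose M hM using hM
  refine ⟨(∑ s ∈ F, M s ^ 2) * F.card, by positivity, fun ξ hξ h1 x T => ?_⟩
  have hpt : ∀ g, ‖deltaIter ℓ f k ξ g x‖ ^ 2 ≤
      (∑ s ∈ F, M s ^ 2) * ∑ s ∈ F, ‖ξ (s⁻¹ * g) x‖ ^ 2 := by
    intro g
    rw [deltaIter_eq_sum ℓ hF]
    refine le_trans ?_ (Finset.sum_mul_sq_le_sq_mul_sq F _ _)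
    refine pow_le_pow_left₀ (norm_nonneg _) ?_ 2
    refine (norm_sum_le _ _).trans (Finset.sum_le_sum fun s _ => ?_)
    rw [norm_mul, norm_mul, norm_pow, ← Complex.ofReal_sub, Complex.norm_real, Real.norm_eq_abs]
    gcongr
    refine le_trans ?_ (hM s ((s⁻¹ * g) • x))
    gcongr
    exact hℓ.abs_sub_le s g x
  calc ∑ g ∈ T, ‖deltaIter ℓ f k ξ g x‖ ^ 2
      ≤ ∑ g ∈ T, (∑ s ∈ F, M s ^ 2) * ∑ s ∈ F, ‖ξ (s⁻¹ * g) x‖ ^ 2 :=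
        Finset.sum_le_sum fun g _ => hpt g
    _ = (∑ s ∈ F, M s ^ 2) * ∑ s ∈ F, ∑ g ∈ T, ‖ξ (s⁻¹ * g) x‖ ^ 2 := by
        rw [← Finset.mul_sum, Finset.sum_comm]
    _ ≤ (∑ s ∈ F, M s ^ 2) * ∑ s ∈ F, 1 := by
        gcongr with s _
        have := hξ.sum_sq_le_one h1 x (T.map (Equiv.mulLeft s⁻¹).toEmbedding)
        simpa using this
    _ = (∑ s ∈ F, M s ^ 2) * F.card := by simp

lemma sqrt_sum_sq_deltaIter_le_lipK [CompactSpace X] {ℓ : Γ → X → ℝ} {f ξ : Γ → X → ℂ}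
    (hℓ : IsLength ℓ) (hf : IsCc f) (k : ℕ) (hξ : IsCc ξ) (h1 : hnorm ξ ≤ 1) (x : X)
    (T : Finset Γ) : Real.sqrt (∑ g ∈ T, ‖deltaIter ℓ f k ξ g x‖ ^ 2) ≤ lipK ℓ k f := by
  obtain ⟨B, hB0, hB⟩ := exists_sum_sq_deltaIter_le hℓ hf k
  have hpt : ∀ η : Γ → X → ℂ, IsCc η → hnorm η ≤ 1 → ∀ y,
      Real.sqrt (∑ᶠ g : Γ, ‖deltaIter ℓ f k η g y‖ ^ 2) ≤ Real.sqrt B := fun η hη h y =>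
    Real.sqrt_le_sqrt (finsum_le_of_forall_sum_le hB0 (hB η hη h y))
  have hmem : hnorm (deltaIter ℓ f k ξ) ≤ lipK ℓ k f := by
    refine le_csSup ⟨Real.sqrt B, ?_⟩ ⟨ξ, hξ, h1, rfl⟩
    rintro r ⟨η, hη, h, rfl⟩
    exact Real.iSup_le (hpt η hη h) (Real.sqrt_nonneg _)
  refine le_trans ?_ hmem
  refine le_trans (Real.sqrt_le_sqrt ?_) (le_ciSup (f := fun y : X =>
    Real.sqrt (∑ᶠ g : Γ, ‖deltaIter ℓ f k ξ g y‖ ^ 2)) ?_ x)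
  · refine sum_le_finsum_of_nonneg (fun _ => sq_nonneg _)
      ((deltaIter_support_finite ℓ hf hξ k).subset fun g hg h => hg ?_) T
    simp [h]
  · refine ⟨Real.sqrt B, ?_⟩
    rintro _ ⟨y, rfl⟩
    exact hpt ξ hξ h1 y

lemma lipK_nonneg (ℓ : Γ → X → ℝ) (k : ℕ) (f : Γ → X → ℂ) : 0 ≤ lipK ℓ k f := by
  refine Real.sSup_nonneg ?_
  rintro r ⟨η, -, -, rfl⟩
  exact Real.iSup_nonneg fun _ => Real.sqrt_nonneg _

/-- A finitely supported unit vector, constant along `X`, has norm at most one. -/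
lemma isCc_const_hnorm_le {ι Y : Type*} [TopologicalSpace Y] {b : ι → ℂ} (T : Finset ι)
    (hb : ∀ h, h ∉ T → b h = 0) (h1 : ∑ h ∈ T, ‖b h‖ ^ 2 ≤ 1) :
    IsCc (fun h (_ : Y) => b h) ∧ hnorm (fun h (_ : Y) => b h) ≤ 1 := by
  refine ⟨⟨fun _ => continuous_const, T.finite_toSet.subset fun h hh => ?_⟩, ?_⟩
  · by_contra hT
    exact hh (by funext; simpa using hb h hT)
  · refine Real.iSup_le (fun _ => ?_) zero_le_one
    rw [finsum_eq_sum_of_support_subset (s := T)]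
    · simpa using h1
    · intro h hh
      by_contra hT
      exact hh (by simp [hb h hT])

lemma sqrt_sum_col_le_lipK [CompactSpace X] {ℓ : Γ → X → ℝ} {f : Γ → X → ℂ}
    (hℓ : IsLength ℓ) (hf : IsCc f) (k : ℕ) (x : X) (T : Finset Γ) :
    Real.sqrt (∑ g ∈ T, (ℓ g x ^ k * ‖f g x‖) ^ 2) ≤ lipK ℓ k f := by
  classical
  obtain ⟨hξ, h1⟩ := isCc_const_hnorm_le (Y := X) (b := fun h : Γ => if h = 1 then 1 else 0) {1}
    (by simp) (by simp)
  convert sqrt_sum_sq_deltaIter_le_lipK hℓ hf k hξ h1 x T using 4 with g _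
  rw [deltaIter_eq_sum (F := insert g hf.2.toFinset) ℓ, Finset.sum_eq_single g]
  · simp [(hℓ.2.2.1 1 x).2 rfl, abs_of_nonneg (hℓ.2.1 g x)]
  · intro s _ hs
    have : s⁻¹ * g ≠ 1 := fun h => hs (inv_mul_eq_one.1 h)
    simp [this]
  · simp
  · intro s hs
    simp only [Finset.mem_insert, not_or] at hs
    simpa using hs.2

lemma sqrt_sum_row_le_lipK [CompactSpace X] {ℓ : Γ → X → ℝ} {f : Γ → X → ℂ}
    (hℓ : IsLength ℓ) (hf : IsCc f) (k : ℕ) (x : X) (T : Finset Γ) :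
    Real.sqrt (∑ g ∈ T, (ℓ g x ^ k * ‖f g⁻¹ (g • x)‖) ^ 2) ≤ lipK ℓ k f := by
  classical
  set S := ∑ g ∈ T, (ℓ g x ^ k * ‖f g⁻¹ (g • x)‖) ^ 2 with hS
  have hS0 : 0 ≤ S := Finset.sum_nonneg fun _ _ => sq_nonneg _
  rcases hS0.eq_or_lt with h0 | hpos
  · rw [← h0, Real.sqrt_zero]
    exact lipK_nonneg ℓ k f
  have hr : 0 < Real.sqrt S := Real.sqrt_pos.2 hpos
  set a : Γ → ℂ := fun h => (-(ℓ h x : ℂ)) ^ k * f h⁻¹ (h • x) with ha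
  have hna : ∀ h, ‖a h‖ = ℓ h x ^ k * ‖f h⁻¹ (h • x)‖ := fun h => by
    simp [ha, abs_of_nonneg (hℓ.2.1 h x)]
  set b : Γ → ℂ := fun h => if h ∈ T then (starRingEnd ℂ) (a h) / (Real.sqrt S : ℂ) else 0 with hb
  obtain ⟨hξ, h1⟩ := isCc_const_hnorm_le (Y := X) (b := b) T (fun h hh => by simp [hb, hh]) (by
    have : ∑ h ∈ T, ‖b h‖ ^ 2 = ∑ h ∈ T, (ℓ h x ^ k * ‖f h⁻¹ (h • x)‖) ^ 2 / S :=
      Finset.sum_congr rfl fun h hh => by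
        simp only [hb, hh, if_true, norm_div, RCLike.norm_conj, hna, Complex.norm_real,
          Real.norm_eq_abs, abs_of_pos hr, div_pow, Real.sq_sqrt hS0]
    rw [this, ← Finset.sum_div, ← hS, div_self hpos.ne'])
  refine le_trans (le_of_eq ?_) (sqrt_sum_sq_deltaIter_le_lipK hℓ hf k hξ h1 x {1})
  have hval : deltaIter ℓ f k (fun h (_ : X) => b h) 1 x = (Real.sqrt S : ℂ) := by
    rw [deltaIter_eq_sum (F := hf.2.toFinset ∪ T.map (Equiv.inv Γ).toEmbedding) ℓ]
    · rw [← Finset.sum_subset Finset.subset_union_right, Finset.sum_map]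
      · have : ∀ h ∈ T, ((ℓ 1 x : ℂ) - ℓ ((h⁻¹)⁻¹ * 1) x) ^ k * f h⁻¹ (((h⁻¹)⁻¹ * 1) • x) *
            b ((h⁻¹)⁻¹ * 1) = ((ℓ h x ^ k * ‖f h⁻¹ (h • x)‖) ^ 2 : ℝ) / (Real.sqrt S : ℂ) := by
          intro h hh
          rw [← hna, Complex.ofReal_pow, ← Complex.mul_conj']
          simp [hb, hh, ha, (hℓ.2.2.1 1 x).2 rfl, mul_div_assoc]
        refine (Finset.sum_congr rfl this).trans ?_
        rw [← Finset.sum_div, ← Complex.ofReal_sum, ← hS, ← Complex.ofReal_div, Real.div_sqrt]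
      · intro s _ hs
        have : s⁻¹ ∉ T := fun h => hs (Finset.mem_map.2 ⟨s⁻¹, h, by simp⟩)
        simp [hb, this]
    · intro s hs
      simp only [Finset.mem_union, not_or] at hs
      simpa using hs.1
  rw [Finset.sum_singleton, hval, Real.sqrt_sq (norm_nonneg _), Complex.norm_real,
    Real.norm_eq_abs, abs_of_pos hr]

lemma rpow_one_add_le {c t p : ℝ} {k : ℕ} (hc : 0 < c) (ht : c ≤ t) (hk : p ≤ k) :
    (1 + t) ^ (2 * p) ≤ ((1 + c⁻¹) ^ k * t ^ k) ^ 2 := by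
  have h0 : 0 < t := hc.trans_le ht
  have h1 : 1 + t ≤ (1 + c⁻¹) * t := by
    have : 1 ≤ c⁻¹ * t := by rwa [inv_mul_eq_div, one_le_div hc]
    linarith
  calc (1 + t) ^ (2 * p) ≤ (1 + t) ^ ((2 * k : ℕ) : ℝ) := by
        refine Real.rpow_le_rpow_of_exponent_le (by linarith) ?_
        push_cast
        linarith
    _ = (1 + t) ^ (2 * k) := Real.rpow_natCast _ _
    _ ≤ ((1 + c⁻¹) * t) ^ (2 * k) := by gcongr
    _ = ((1 + c⁻¹) ^ k * t ^ k) ^ 2 := by rw [← mul_pow, ← pow_mul, mul_comm 2 k]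

/-- A weighted `ℓ²`-sum with weights dominated by `α w` is bounded by `α` times the bound on the
`w`-weighted sums. -/
lemma iSup_sqrt_finsum_le {ι Y : Type*} {u v : ι → Y → ℝ} {α L : ℝ} (hα : 0 ≤ α)
    (hL : 0 ≤ L) (huv : ∀ g x, u g x ≤ α ^ 2 * v g x ^ 2)
    (hv : ∀ x (T : Finset ι), Real.sqrt (∑ g ∈ T, v g x ^ 2) ≤ L) :
    ⨆ x : Y, Real.sqrt (∑ᶠ g : ι, u g x) ≤ α * L := by
  refine Real.iSup_le (fun x => Real.sqrt_le_iff.2 ⟨by positivity, ?_⟩) (by positivity)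
  refine finsum_le_of_forall_sum_le (by positivity) fun T => ?_
  calc ∑ g ∈ T, u g x ≤ α ^ 2 * ∑ g ∈ T, v g x ^ 2 := by
        rw [Finset.mul_sum]
        exact Finset.sum_le_sum fun g _ => huv g x
    _ ≤ α ^ 2 * L ^ 2 := by
        gcongr
        exact (Real.sqrt_le_left hL).1 (hv x T)
    _ = (α * L) ^ 2 := by ring

/-- under rapid decay, `‖f − f|_X‖_red ≤ C α L_ℓ^k(f)` for all
`f ∈ C_c(Γ⋉X)`, where `f|_X` is the restriction of `f` to the unit space extended by zero. -/
theorem stmt_12 [DecidableEq Γ] [CompactSpace X] [T2Space X] [ContinuousConstSMul Γ X]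
    (ℓ : Γ → X → ℝ) (hℓ : IsLength ℓ) (hprop : IsProperLen ℓ)
    (p C : ℝ) (hp : 0 < p) (hC : 0 < C)
    (hRD : ∀ f : Γ → X → ℂ, IsCc f → redNorm f ≤ C * norm2 ℓ p f)
    (k : ℕ) (hk : p < (k : ℝ)) :
    ∃ α : ℝ, 0 < α ∧ ∀ f : Γ → X → ℂ, IsCc f →
      redNorm (f - fun g x => if g = 1 then f 1 x else 0) ≤ C * α * lipK ℓ k f := by
  obtain ⟨c, hc, hcl⟩ := hℓ.exists_pos_le hprop
  refine ⟨(1 + c⁻¹) ^ k, by positivity, fun f hf => ?_⟩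
  set f₀ : Γ → X → ℂ := f - fun g x => if g = 1 then f 1 x else 0 with hf₀
  have hone : f₀ 1 = 0 := by funext x; simp [hf₀]
  have hne : ∀ g, g ≠ 1 → f₀ g = f g := fun g hg => by funext x; simp [hf₀, hg]
  have hcc : IsCc f₀ := by
    refine ⟨fun g => ?_, hf.2.subset fun g hg => ?_⟩
    · by_cases hg : g = 1
      · rw [hg, hone]
        exact continuous_const
      · rw [hne g hg]
        exact hf.1 g
    · have h1 : g ≠ 1 := fun h => hg (h ▸ hone)
      rw [Set.mem_ofPred_eq, ← hne g h1]
      exact hg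
  have hL := lipK_nonneg ℓ k f
  have hα : 0 ≤ (1 + c⁻¹) ^ k := by positivity
  refine (hRD f₀ hcc).trans ?_
  rw [mul_assoc]
  refine mul_le_mul_of_nonneg_left (max_le ?_ ?_) hC.le
  · refine iSup_sqrt_finsum_le hα hL (fun g x => ?_) (sqrt_sum_col_le_lipK hℓ hf k)
    by_cases hg : g = 1
    · subst hg
      rw [hone]
      simp only [Pi.zero_apply, norm_zero, ne_eq, OfNat.ofNat_ne_zero, not_false_eq_true,
        zero_pow, zero_mul]
      positivity
    · rw [hne g hg]
      calc _ ≤ ‖f g x‖ ^ 2 * ((1 + c⁻¹) ^ k * ℓ g x ^ k) ^ 2 := by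
            gcongr
            exact rpow_one_add_le hc (hcl g hg x) hk.le
        _ = _ := by ring
  · refine iSup_sqrt_finsum_le hα hL (fun g x => ?_) (sqrt_sum_row_le_lipK hℓ hf k)
    by_cases hg : g = 1
    · subst hg
      rw [inv_one, hone]
      simp only [Pi.zero_apply, norm_zero, ne_eq, OfNat.ofNat_ne_zero, not_false_eq_true,
        zero_pow, zero_mul]
      positivity
    · rw [hne g⁻¹ (inv_ne_one.2 hg)]
      calc _ ≤ ‖f g⁻¹ (g • x)‖ ^ 2 * ((1 + c⁻¹) ^ k * ℓ g x ^ k) ^ 2 := by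
            gcongr
            exact rpow_one_add_le hc (hcl g hg x) hk.le
        _ = _ := by ring
end
end
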